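/- arXiv:2002.10684 — 8 statements merged into one kernel-verified Lean document; each statement's English description precedes it below -/
import Mathlib

section
/- Let a_0, a_1, a_2, … be real numbers and let (ξ_k)_{k≥0} be a sequence of real numbers satisfying the recursion ξ_{k+2} = a_k·ξ_k − (a_{k+1} − 1)·ξ_{k+1} for all k ≥ 0. If ξ_k = 0 for some k ≥ 0, then for every integer l ≥ 2 one has ξ_{k+l} = (−1)^{l−1}·ξ_{k+1}·μ(a_{k+1},…,a_{k+l−1}). -/
/-- For a finite tuple `(b_1, …, b_m)` of real numbers,
`μ(b_1,…,b_m) = b_1⋯b_m − b_2⋯b_m + ⋯ + (−1)^{m−1} b_m + (−1)^m`, with `μ(∅) = 1`. -/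
def chainMuR (a : List ℝ) : ℝ :=
  ∑ k ∈ Finset.range (a.length + 1), (-1 : ℝ) ^ k * (a.drop k).prod

theorem chainMuR_nil : chainMuR [] = 1 := by
  simp [chainMuR]

theorem chainMuR_concat (L : List ℝ) (x : ℝ) :
    chainMuR (L ++ [x]) = chainMuR L * x + (-1) ^ (L.length + 1) := by
  unfold chainMuR
  rw [List.length_append, List.length_singleton, Finset.sum_range_succ, Finset.sum_mul]
  congr 1
  · refine Finset.sum_congr rfl fun i hi => ?_
    rw [List.drop_append_of_le_length (Nat.lt_succ_iff.mp (Finset.mem_range.mp hi)),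
      List.prod_append, List.prod_singleton, mul_assoc]
  · simp

theorem chainMuR_map_range_succ (b : ℕ → ℝ) (n : ℕ) :
    chainMuR ((List.range (n + 1)).map b) =
      chainMuR ((List.range n).map b) * b n + (-1) ^ (n + 1) := by
  simp [List.range_succ, chainMuR_concat]

theorem eq_chainMuR_of_recurrence (b η : ℕ → ℝ) (h₁ : η 1 = -(b 0 - 1) * η 0)
    (hrec : ∀ n, η (n + 2) = b n * η n - (b (n + 1) - 1) * η (n + 1)) (n : ℕ) :
    η n = (-1) ^ n * η 0 * chainMuR ((List.range n).map b) := by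
  induction n using Nat.twoStepInduction with
  | zero => simp [chainMuR_nil]
  | one =>
    rw [h₁, chainMuR_map_range_succ]
    simp only [List.range_zero, List.map_nil, chainMuR_nil]
    ring
  | more n ih₀ ih₁ =>
    rw [hrec, ih₀, ih₁, chainMuR_map_range_succ b (n + 1), chainMuR_map_range_succ b n]
    ring

/-- If a sequence `ξ` of real numbers satisfies `ξ_{k+2} = a_k ξ_k − (a_{k+1} − 1) ξ_{k+1}`
for all `k`, and `ξ_k = 0` for some `k`, then for every `l ≥ 2`,
`ξ_{k+l} = (−1)^{l−1} ξ_{k+1} μ(a_{k+1}, …, a_{k+l−1})`. -/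
theorem stmt2 (a ξ : ℕ → ℝ)
    (hrec : ∀ k, ξ (k + 2) = a k * ξ k - (a (k + 1) - 1) * ξ (k + 1))
    (k : ℕ) (hk : ξ k = 0) :
    ∀ l, 2 ≤ l →
      ξ (k + l) = (-1 : ℝ) ^ (l - 1) * ξ (k + 1) *
        chainMuR ((List.range (l - 1)).map fun i => a (k + 1 + i)) := by
  intro l hl
  obtain ⟨n, rfl⟩ : ∃ n, l = n + 1 := ⟨l - 1, by lia⟩
  have hrec' (n : ℕ) : ξ (k + 1 + (n + 2)) =
      a (k + 1 + n) * ξ (k + 1 + n) - (a (k + 1 + (n + 1)) - 1) * ξ (k + 1 + (n + 1)) :=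
    hrec (k + 1 + n)
  have h₁ : ξ (k + 1 + 1) = -(a (k + 1) - 1) * ξ (k + 1) := by
    have := hrec k
    rw [hk] at this
    linarith
  simpa [add_assoc, add_comm 1 n] using eq_chainMuR_of_recurrence
    (fun i => a (k + 1 + i)) (fun i => ξ (k + 1 + i)) h₁ hrec' n
end

section
/- Let a = (a_1,…,a_n) be positive integers (n ≥ 1). In the polynomial ring ℤ[t], the product ∏_{0 ≤ i ≤ n, i ≡ n (mod 2)} (1 − t^{r_i}) is divisible by the product ∏_{0 ≤ i ≤ n, i ≢ n (mod 2)} (1 − t^{r_i}); equivalently, the alternating product ∏_{i=0}^{n}(1 − t^{r_i})^{(−1)^{i+n}} is a polynomial P_a(t) with integer coefficients. Moreover P_a has degree μ(a) and constant coefficient 1. -/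
/-- The Milnor number of the chain type singularity associated to the tuple
`a = (a_1, …, a_n)`, with `μ(∅) = 1`. -/
def chainMu (a : List ℕ) : ℤ :=
  ∑ k ∈ Finset.range (a.length + 1), (-1 : ℤ) ^ k * ((a.drop k).prod : ℤ)

/-- `r_i = a_{n−i+1} ⋯ a_n`, the product of the last `i` entries of `a`. -/
def chainR (a : List ℕ) (i : ℕ) : ℕ := (a.drop (a.length - i)).prod

open Polynomial in
theorem natDegree_one_sub_X_pow (m : ℕ) : (1 - (X : ℤ[X]) ^ m).natDegree = m := by
  rw [← neg_sub, natDegree_neg, ← C_1, natDegree_X_pow_sub_C]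

open Polynomial in
theorem coeff_zero_one_sub_X_pow {m : ℕ} (hm : 0 < m) : (1 - (X : ℤ[X]) ^ m).coeff 0 = 1 := by
  simp [coeff_X_pow, hm.ne]

open Polynomial in
theorem one_sub_X_pow_ne_zero {m : ℕ} (hm : 0 < m) : (1 - (X : ℤ[X]) ^ m) ≠ 0 := fun h => by
  simpa [h] using coeff_zero_one_sub_X_pow hm

open Polynomial in
theorem exists_one_sub_X_pow_mul_eq {x m : ℕ} (hx : 0 < x) (hm : 0 < m) :
    ∃ Q : ℤ[X], 1 - (X : ℤ[X]) ^ (x * m) = Q * (1 - X ^ m) ∧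
      (Q.natDegree : ℤ) = (x * m : ℤ) - m ∧ Q.coeff 0 = 1 := by
  obtain ⟨Q, hQ⟩ : (1 - (X : ℤ[X]) ^ m) ∣ 1 - X ^ (x * m) := by
    simpa [← pow_mul, mul_comm m x] using sub_dvd_pow_sub_pow (1 : ℤ[X]) (X ^ m) x
  have hQ0 : Q ≠ 0 := by
    rintro rfl
    exact one_sub_X_pow_ne_zero (Nat.mul_pos hx hm) (by simpa using hQ)
  refine ⟨Q, by rw [hQ, mul_comm], ?_, ?_⟩
  · have h := congrArg natDegree hQ
    rw [natDegree_mul (one_sub_X_pow_ne_zero hm) hQ0, natDegree_one_sub_X_pow,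
      natDegree_one_sub_X_pow] at h
    zify at h
    linarith
  · have h := congrArg (fun p => coeff p 0) hQ
    simp only [mul_coeff_zero, coeff_zero_one_sub_X_pow (Nat.mul_pos hx hm),
      coeff_zero_one_sub_X_pow hm, one_mul] at h
    exact h.symm

theorem chainMu_cons (x : ℕ) (l : List ℕ) :
    chainMu (x :: l) = ((x :: l).prod : ℤ) - chainMu l := by
  unfold chainMu
  rw [List.length_cons, Finset.sum_range_succ']
  simp only [List.drop_succ_cons, List.drop_zero, pow_succ, pow_zero, one_mul, mul_neg_one,
    neg_mul, Finset.sum_neg_distrib]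
  ring

theorem chainR_cons_of_le (x : ℕ) {l : List ℕ} {i : ℕ} (hi : i ≤ l.length) :
    chainR (x :: l) i = chainR l i := by
  unfold chainR
  rw [List.length_cons, Nat.succ_sub hi, List.drop_succ_cons]

theorem chainR_length (l : List ℕ) : chainR l l.length = l.prod := by
  simp [chainR]

/-- The product of `1 - t ^ r_i` over the `i` with `i ≡ n (mod 2)`. -/
noncomputable def chainNum (a : List ℕ) : Polynomial ℤ :=
  ∏ i ∈ (Finset.range (a.length + 1)).filter (fun i => i % 2 = a.length % 2),
    (1 - (Polynomial.X : Polynomial ℤ) ^ chainR a i)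

/-- The product of `1 - t ^ r_i` over the `i` with `i ≢ n (mod 2)`. -/
noncomputable def chainDen (a : List ℕ) : Polynomial ℤ :=
  ∏ i ∈ (Finset.range (a.length + 1)).filter (fun i => ¬ i % 2 = a.length % 2),
    (1 - (Polynomial.X : Polynomial ℤ) ^ chainR a i)

theorem chainNum_cons (x : ℕ) (l : List ℕ) :
    chainNum (x :: l) = (1 - Polynomial.X ^ (x :: l).prod) * chainDen l := by
  unfold chainNum chainDen
  rw [← chainR_length (x :: l), List.length_cons, Finset.range_add_one, Finset.filter_insert,
    if_pos rfl, Finset.prod_insert (by simp)]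
  congr 1
  refine Finset.prod_congr (Finset.filter_congr fun i _ => by omega) fun i hi => ?_
  rw [chainR_cons_of_le x (by simp at hi; omega)]

theorem chainDen_cons (x : ℕ) (l : List ℕ) : chainDen (x :: l) = chainNum l := by
  unfold chainNum chainDen
  rw [List.length_cons, Finset.range_add_one, Finset.filter_insert, if_neg (by simp)]
  refine Finset.prod_congr (Finset.filter_congr fun i _ => by omega) fun i hi => ?_
  rw [chainR_cons_of_le x (by simp at hi; omega)]

theorem chainNum_nil : chainNum [] = 1 - Polynomial.X := by
  simp [chainNum, chainR, Finset.filter_singleton]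

theorem chainDen_nil : chainDen [] = 1 := by
  simp [chainDen, Finset.filter_singleton]

theorem exists_chainNum_eq_mul_chainDen : ∀ a : List ℕ, (∀ x ∈ a, 0 < x) →
    ∃ P : Polynomial ℤ, chainNum a = P * chainDen a ∧
      (P.natDegree : ℤ) = chainMu a ∧ P.coeff 0 = 1
  | [], _ => by
    refine ⟨1 - Polynomial.X, by rw [chainNum_nil, chainDen_nil, mul_one], ?_, by simp⟩
    have h := natDegree_one_sub_X_pow 1
    rw [pow_one] at h
    simp [h, chainMu]
  | [x], hpos => by
    obtain ⟨Q, hQ, hdeg, hcoeff⟩ := exists_one_sub_X_pow_mul_eq (hpos x (by simp)) one_pos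
    refine ⟨Q, ?_, ?_, hcoeff⟩
    · rw [chainNum_cons, chainDen_cons, chainDen_nil, chainNum_nil]
      simpa using hQ
    · rw [hdeg, chainMu_cons]
      simp [chainMu]
  | x :: y :: l, hpos => by
    obtain ⟨P, hP, hPdeg, hPcoeff⟩ := exists_chainNum_eq_mul_chainDen l fun z hz =>
      hpos z (by simp [hz])
    obtain ⟨Q, hQ, hQdeg, hQcoeff⟩ := exists_one_sub_X_pow_mul_eq (hpos x (by simp))
      (List.prod_pos (s := y :: l) fun z hz => hpos z (List.mem_cons_of_mem x hz))
    have hP0 : P ≠ 0 := by rintro rfl; simp at hPcoeff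
    have hQ0 : Q ≠ 0 := by rintro rfl; simp at hQcoeff
    refine ⟨Q * P, ?_, ?_, ?_⟩
    · rw [chainNum_cons, chainDen_cons, chainDen_cons, chainNum_cons, hP, List.prod_cons, hQ]
      ring
    · rw [Polynomial.natDegree_mul hQ0 hP0, chainMu_cons, chainMu_cons, Nat.cast_add, hQdeg,
        hPdeg, List.prod_cons (a := x)]
      push_cast
      ring
    · rw [Polynomial.mul_coeff_zero, hPcoeff, hQcoeff, one_mul]

/-- For `a = (a_1,…,a_n)` positive (`n ≥ 1`), in `ℤ[t]` the product
`∏_{0 ≤ i ≤ n, i ≡ n (2)} (1 − t^{r_i})` is divisible by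
`∏_{0 ≤ i ≤ n, i ≢ n (2)} (1 − t^{r_i})`: the alternating product
`∏_{i=0}^{n} (1 − t^{r_i})^{(−1)^{i+n}}` is a polynomial `P_a` with integer
coefficients, of degree `μ(a)` and with constant coefficient `1`. -/
theorem stmt3 (a : List ℕ) (hne : a ≠ []) (hpos : ∀ x ∈ a, 0 < x) :
    ∃ P : Polynomial ℤ,
      (∏ i ∈ (Finset.range (a.length + 1)).filter (fun i => i % 2 = a.length % 2),
          (1 - (Polynomial.X : Polynomial ℤ) ^ chainR a i)) =
        P * ∏ i ∈ (Finset.range (a.length + 1)).filter (fun i => ¬ i % 2 = a.length % 2),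
          (1 - (Polynomial.X : Polynomial ℤ) ^ chainR a i) ∧
      (P.natDegree : ℤ) = chainMu a ∧ P.coeff 0 = 1 := by
  exact exists_chainNum_eq_mul_chainDen a hpos
end

section
/- Let a = (a_1,…,a_n) be positive integers, let ζ ∈ ℂ* satisfy ζ^{a_1a_2⋯a_n} = 1, and set e_k := (−1)^{k−1} a_1a_2⋯a_{k−1} for 1 ≤ k ≤ n (so e_1 = 1; negative integer powers of ζ are taken as powers of ζ^{−1}). Then p_a(ζ^{e_1}z_1, …, ζ^{e_n}z_n) = p_a(z_1,…,z_n) for all (z_1,…,z_n) ∈ ℂ^n. In particular the diagonal map z ↦ (ζ^{e_1}z_1,…,ζ^{e_n}z_n) preserves the hypersurface M_a := p_a^{−1}(1) and multiplies the first coordinate z_1 by ζ. -/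
/-- The chain type invertible polynomial
`p_a(z_1,…,z_n) = z_1^{a_1} z_2 + ⋯ + z_{n−1}^{a_{n−1}} z_n + z_n^{a_n}`,
with variables indexed from `0`. -/
noncomputable def chainPoly (a : List ℕ) (z : ℕ → ℂ) : ℂ :=
  ∑ k ∈ Finset.range a.length,
    z k ^ a.getD k 1 * (if k + 1 < a.length then z (k + 1) else 1)

/-- The prefix product of length `k + 1` for `k < a.length`, in terms of `getD`. -/
lemma List.prod_take_succ_getD (a : List ℕ) {k : ℕ} (hk : k < a.length) :
    (a.take (k + 1)).prod = (a.take k).prod * a.getD k 1 := by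
  rw [List.prod_take_succ a k hk, List.getD_eq_getElem a 1 hk]

/-- A diagonal map whose weights `w` satisfy `w k ^ a_k * w (k + 1) = 1` for all but the last
index, and `w k ^ a_k = 1` for the last index, preserves the chain polynomial. -/
lemma chainPoly_mul_eq (a : List ℕ) (w z : ℕ → ℂ)
    (hw : ∀ k, k + 1 < a.length → w k ^ a.getD k 1 * w (k + 1) = 1)
    (hlast : ∀ k, k + 1 = a.length → w k ^ a.getD k 1 = 1) :
    chainPoly a (fun k => w k * z k) = chainPoly a z := by
  refine Finset.sum_congr rfl fun k hk => ?_
  rw [Finset.mem_range] at hk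
  simp only [mul_pow]
  split_ifs with h
  · rw [mul_mul_mul_comm, hw k h, one_mul]
  · rw [hlast k (by omega), one_mul]

/-- Let `ζ ∈ ℂ*` with `ζ^{a_1⋯a_n} = 1`, and `e_k = (−1)^{k−1} a_1⋯a_{k−1}`
(`0`-indexed: `e_j = (−1)^j a_1⋯a_j` for the variable `z_{j+1}`, so `e_0 = 1`).
Then `p_a(ζ^{e_1} z_1, …, ζ^{e_n} z_n) = p_a(z_1,…,z_n)`; in particular the
diagonal map preserves `M_a = p_a^{−1}(1)` and multiplies the first coordinate
by `ζ`. -/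
theorem stmt11 (a : List ℕ) (hne : a ≠ []) (hpos : ∀ x ∈ a, 0 < x)
    (ζ : ℂ) (hζ : ζ ^ a.prod = 1) (z : ℕ → ℂ) :
    chainPoly a (fun k => ζ ^ ((-1 : ℤ) ^ k * ((a.take k).prod : ℤ)) * z k) =
      chainPoly a z ∧
    (chainPoly a z = 1 →
      chainPoly a (fun k => ζ ^ ((-1 : ℤ) ^ k * ((a.take k).prod : ℤ)) * z k) = 1) ∧
    ζ ^ ((-1 : ℤ) ^ (0 : ℕ) * ((a.take 0).prod : ℤ)) * z 0 = ζ * z 0 := by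
  have hζ0 : ζ ≠ 0 := by
    rintro rfl
    exact zero_ne_one ((zero_pow (List.prod_pos hpos).ne').symm.trans hζ)
  have key : chainPoly a (fun k => ζ ^ ((-1 : ℤ) ^ k * ((a.take k).prod : ℤ)) * z k) =
      chainPoly a z := by
    refine chainPoly_mul_eq a _ z (fun k hk => ?_) (fun k hk => ?_)
    · rw [← zpow_natCast, ← zpow_mul, ← zpow_add₀ hζ0,
        List.prod_take_succ_getD a (by omega : k < a.length)]
      convert zpow_zero ζ using 2
      push_cast
      ring
    · have hprod := List.prod_take_succ_getD a (by omega : k < a.length)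
      rw [hk, List.take_length] at hprod
      rw [← zpow_natCast, ← zpow_mul, mul_assoc, ← Nat.cast_mul, ← hprod, mul_comm, zpow_mul,
        zpow_natCast, hζ, one_zpow]
  exact ⟨key, fun h => key.trans h, by simp⟩
end

section
/- Let a = (a_1,…,a_n) be positive integers, let η ∈ ℂ* satisfy η^{μ(a)} = 1, and set m_k := (−1)^{k−1} μ(a_1,…,a_{k−1}) for 1 ≤ k ≤ n (so m_1 = 1; negative integer powers of η are taken as powers of η^{−1}). Then for all (z_1,…,z_n) ∈ ℂ^n, p_a(η^{m_1}z_1, …, η^{m_n}z_n) + η^{m_1}z_1 = η · ( p_a(z_1,…,z_n) + z_1 ); that is, the Morsification p_a + z_1 is equivariant for this diagonal action of the μ(a)-th roots of unity on ℂ^n and the rotation by η on the target. -/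
theorem chainMu_append_singleton (a : List ℕ) (x : ℕ) :
    chainMu (a ++ [x]) = x * chainMu a + (-1) ^ (a.length + 1) := by
  unfold chainMu
  rw [List.length_append, List.length_singleton, Finset.sum_range_succ, Finset.mul_sum]
  congr 1
  · refine Finset.sum_congr rfl fun k hk => ?_
    have h : k ≤ a.length := Nat.lt_succ_iff.mp (Finset.mem_range.mp hk)
    rw [List.drop_append_of_le_length h, List.prod_append, List.prod_singleton]
    push_cast
    ring
  · simp

theorem chainMu_take_succ (a : List ℕ) {k : ℕ} (hk : k < a.length) :
    chainMu (a.take (k + 1)) = a.getD k 1 * chainMu (a.take k) + (-1) ^ (k + 1) := by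
  rw [← List.take_append_getElem hk, chainMu_append_singleton, List.getD_eq_getElem _ _ hk,
    List.length_take_of_le hk.le]

/-- The weights satisfy `a_k m_k + m_{k+1} = 1` (indexed from `0`). -/
theorem chain_weight_relation (a : List ℕ) {k : ℕ} (hk : k < a.length) :
    (-1 : ℤ) ^ k * chainMu (a.take k) * a.getD k 1 +
      (-1 : ℤ) ^ (k + 1) * chainMu (a.take (k + 1)) = 1 := by
  have h : ((-1 : ℤ) ^ k) * (-1) ^ k = 1 := by
    rw [← mul_pow]; simp
  rw [chainMu_take_succ a hk, pow_succ]
  linear_combination h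

/-- Let `η ∈ ℂ*` with `η^{μ(a)} = 1`, and `m_k = (−1)^{k−1} μ(a_1,…,a_{k−1})`
(`0`-indexed: `m_j = (−1)^j μ(a_1,…,a_j)` for the variable `z_{j+1}`, so
`m_0 = 1`). Then `p_a(η^{m_1} z_1, …, η^{m_n} z_n) + η^{m_1} z_1
= η (p_a(z_1,…,z_n) + z_1)`: the Morsification `p_a + z_1` is equivariant for
this diagonal action of the `μ(a)`-th roots of unity. -/
theorem stmt12 (a : List ℕ) (hne : a ≠ []) (hpos : ∀ x ∈ a, 0 < x)
    (η : ℂ) (hη : η ≠ 0) (hη1 : η ^ chainMu a = 1) (z : ℕ → ℂ) :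
    chainPoly a (fun k => η ^ ((-1 : ℤ) ^ k * chainMu (a.take k)) * z k) +
        η ^ ((-1 : ℤ) ^ (0 : ℕ) * chainMu (a.take 0)) * z 0 =
      η * (chainPoly a z + z 0) := by
  rw [mul_add]
  congr 1
  · unfold chainPoly
    rw [Finset.mul_sum]
    refine Finset.sum_congr rfl fun k hk => ?_
    have hk' : k < a.length := Finset.mem_range.mp hk
    have hη2 : (η ^ ((-1 : ℤ) ^ k * chainMu (a.take k))) ^ a.getD k 1 *
        η ^ ((-1 : ℤ) ^ (k + 1) * chainMu (a.take (k + 1))) = η := by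
      rw [← zpow_natCast, ← zpow_mul, ← zpow_add₀ hη, chain_weight_relation a hk', zpow_one]
    rw [mul_pow]
    split_ifs with h
    · linear_combination (z k ^ a.getD k 1 * z (k + 1)) * hη2
    · have hη3 : η ^ ((-1 : ℤ) ^ (k + 1) * chainMu (a.take (k + 1))) = 1 := by
        rw [List.take_of_length_le (not_lt.mp h), mul_comm, zpow_mul, hη1, one_zpow]
      rw [hη3, mul_one] at hη2
      rw [hη2]
      ring
  · simp [chainMu]
end

section
/- Let a = (a_1,…,a_n) be positive integers with a_n ≥ 2. Then the only critical point of the polynomial map p_a : ℂ^n → ℂ is the origin; that is, all n complex partial derivatives of p_a vanish simultaneously at z ∈ ℂ^n if and only if z = 0. -/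
open MvPolynomial

/-- The chain type invertible polynomial
`p_a(z_1,…,z_n) = z_1^{a_1} z_2 + ⋯ + z_{n−1}^{a_{n−1}} z_n + z_n^{a_n}` as a
multivariate polynomial over `ℂ` in variables indexed by `Fin n`. -/
noncomputable def chainMv (n : ℕ) (a : Fin n → ℕ) : MvPolynomial (Fin n) ℂ :=
  ∑ k : Fin n,
    X k ^ a k * (if h : (k : ℕ) + 1 < n then X (⟨(k : ℕ) + 1, h⟩ : Fin n) else 1)

/-- The value at `z` of the `k`-th partial derivative of `p_a`. -/
theorem eval_pderiv_chainMv {n : ℕ} (a : Fin n → ℕ) (z : Fin n → ℂ) (k : Fin n) :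
    eval z (pderiv k (chainMv n a)) =
      a k * z k ^ (a k - 1) * (if h : (k : ℕ) + 1 < n then z ⟨k + 1, h⟩ else 1) +
        ∑ j : Fin n, if (j : ℕ) + 1 = k then z j ^ a j else 0 := by
  have key (j : Fin n) :
      eval z (pderiv k (X j ^ a j *
        (if h : (j : ℕ) + 1 < n then X (⟨(j : ℕ) + 1, h⟩ : Fin n) else 1))) =
      (if k = j then
        a j * z j ^ (a j - 1) * (if h : (j : ℕ) + 1 < n then z ⟨j + 1, h⟩ else 1) else 0) +
        if (j : ℕ) + 1 = k then z j ^ a j else 0 := by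
    rw [pderiv_mul, pderiv_pow]
    by_cases h : (j : ℕ) + 1 < n
    · have hk : (⟨(j : ℕ) + 1, h⟩ : Fin n) = k ↔ (j : ℕ) + 1 = k := Fin.ext_iff
      simp only [h, dite_true, pderiv_X, Pi.single_apply, hk, @eq_comm _ j k]
      split_ifs <;> simp_all
    · have hk : (j : ℕ) + 1 ≠ k := by have := k.isLt; omega
      simp only [h, dite_false, pderiv_X, Pi.single_apply, hk, @eq_comm _ j k]
      split_ifs <;> simp_all
  rw [chainMv, map_sum, map_sum, Finset.sum_congr rfl fun j _ => key j,
    Finset.sum_add_distrib, Finset.sum_ite_eq]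
  simp

theorem eval_pderiv_chainMv_zero {n : ℕ} (a : Fin n → ℕ) (z : Fin n → ℂ) (h : 0 < n) :
    eval z (pderiv ⟨0, h⟩ (chainMv n a)) =
      a ⟨0, h⟩ * z ⟨0, h⟩ ^ (a ⟨0, h⟩ - 1) * (if h : 1 < n then z ⟨1, h⟩ else 1) := by
  simp [eval_pderiv_chainMv]

theorem eval_pderiv_chainMv_succ {n : ℕ} (a : Fin n → ℕ) (z : Fin n → ℂ) (i : ℕ)
    (h : i + 1 < n) :
    eval z (pderiv ⟨i + 1, h⟩ (chainMv n a)) =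
      a ⟨i + 1, h⟩ * z ⟨i + 1, h⟩ ^ (a ⟨i + 1, h⟩ - 1) *
          (if h : i + 1 + 1 < n then z ⟨i + 1 + 1, h⟩ else 1) +
        z ⟨i, by omega⟩ ^ a ⟨i, by omega⟩ := by
  rw [eval_pderiv_chainMv, Finset.sum_eq_single ⟨i, by omega⟩]
  · simp
  · intro j _ hj
    exact if_neg fun e => hj (Fin.ext (by simpa using e))
  · simp

/-- At a critical point of `p_a` every monomial of `p_a` vanishes. -/
theorem chainMv_monomial_eq_zero {n : ℕ} {a : Fin n → ℕ} (hpos : ∀ k, 0 < a k)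
    {z : Fin n → ℂ} (hz : ∀ k : Fin n, eval z (pderiv k (chainMv n a)) = 0) (i : ℕ)
    (hi : i < n) :
    z ⟨i, hi⟩ ^ a ⟨i, hi⟩ * (if h : i + 1 < n then z ⟨i + 1, h⟩ else 1) = 0 := by
  have ha : (a ⟨i, hi⟩ : ℂ) ≠ 0 := Nat.cast_ne_zero.mpr (hpos _).ne'
  have hp : z ⟨i, hi⟩ ^ a ⟨i, hi⟩ = z ⟨i, hi⟩ ^ (a ⟨i, hi⟩ - 1) * z ⟨i, hi⟩ :=
    (pow_sub_one_mul (hpos _).ne' _).symm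
  refine (mul_eq_zero.mp ?_).resolve_left ha
  rw [hp]
  cases i with
  | zero =>
    have h0 := hz ⟨0, hi⟩
    rw [eval_pderiv_chainMv_zero] at h0
    linear_combination z ⟨0, hi⟩ * h0
  | succ i =>
    have h1 := hz ⟨i + 1, hi⟩
    rw [eval_pderiv_chainMv_succ] at h1
    have ih := chainMv_monomial_eq_zero hpos hz i (by omega)
    rw [dif_pos hi] at ih
    linear_combination z ⟨i + 1, hi⟩ * h1 - ih

/-- For `a = (a_1,…,a_n)` positive with `a_n ≥ 2`, the only critical point of
`p_a : ℂⁿ → ℂ` is the origin: all `n` complex partial derivatives vanish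
simultaneously at `z` if and only if `z = 0`. -/
theorem stmt13 (n : ℕ) (hn : 0 < n) (a : Fin n → ℕ) (hpos : ∀ k, 0 < a k)
    (hlast : 2 ≤ a ⟨n - 1, by omega⟩) (z : Fin n → ℂ) :
    (∀ k : Fin n, eval z (pderiv k (chainMv n a)) = 0) ↔ z = 0 := by
  constructor
  · intro hz
    have hl : z ⟨n - 1, by omega⟩ = 0 := by
      have := chainMv_monomial_eq_zero hpos hz (n - 1) (by omega)
      rw [dif_neg (by omega), mul_one] at this
      exact eq_zero_of_pow_eq_zero this
    have hall (m : ℕ) (i : ℕ) (hi : i < n) (him : n ≤ i + 1 + m) : z ⟨i, hi⟩ = 0 := by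
      induction m using Nat.strong_induction_on generalizing i with
      | _ m ih =>
        by_cases hin : i + 1 < n
        · have h1 := hz ⟨i + 1, hin⟩
          rw [eval_pderiv_chainMv_succ] at h1
          refine eq_zero_of_pow_eq_zero (n := a ⟨i, hi⟩) ?_
          by_cases h2 : i + 1 + 1 < n
          · rw [dif_pos h2, ih (m - 2) (by omega) (i + 1 + 1) h2 (by omega)] at h1
            simpa using h1
          · obtain rfl : n = i + 1 + 1 := by omega
            have hl' : z ⟨i + 1, hin⟩ = 0 := hl
            have ha : a ⟨i + 1, hin⟩ - 1 ≠ 0 := Nat.sub_ne_zero_of_lt hlast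
            rw [hl', zero_pow ha] at h1
            simpa using h1
        · obtain rfl : i = n - 1 := by omega
          exact hl
    ext i
    exact hall n i i.isLt (by omega)
  · rintro rfl k
    rw [eval_pderiv_chainMv]
    have hs : (∑ j : Fin n, if (j : ℕ) + 1 = k then (0 : Fin n → ℂ) j ^ a j else 0) = 0 :=
      Finset.sum_eq_zero fun j _ => by simp [(hpos j).ne']
    rw [hs, add_zero]
    by_cases h : (k : ℕ) + 1 < n
    · simp [h]
    · have hk : k = ⟨n - 1, by omega⟩ := Fin.ext (by have := k.isLt; simp only; omega)
      have ha : a k - 1 ≠ 0 := Nat.sub_ne_zero_of_lt (hk ▸ hlast)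
      simp [zero_pow ha]
end

section
/- Let a = (a_1,…,a_n) be positive integers with a_n ≥ 2, and let g := p_a + z_1 : ℂ^n → ℂ. Then there exists c ∈ ℂ* such that the projection z ↦ z_1 restricts to a bijection from the set of critical points of g onto {w ∈ ℂ : w^{μ(a)} = c}. In particular g has exactly μ(a) critical points, they have pairwise distinct critical values, the set of critical values equals {(μ(a)/(a_1⋯a_n))·w : w^{μ(a)} = c} (μ(a) points equidistributed on a circle centered at the origin), and every critical point of g is nondegenerate, i.e. the determinant of the complex Hessian matrix of g is nonzero there. -/
open MvPolynomial

/-- The Morsification `g = p_a + z_1`. -/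
noncomputable def chainMors (n : ℕ) (hn : 0 < n) (a : Fin n → ℕ) :
    MvPolynomial (Fin n) ℂ :=
  chainMv n a + X (⟨0, hn⟩ : Fin n)

/-- The set of critical points of `g = p_a + z_1 : ℂⁿ → ℂ`. -/
def morsCrit (n : ℕ) (hn : 0 < n) (a : Fin n → ℕ) : Set (Fin n → ℂ) :=
  {z | ∀ k : Fin n, eval z (pderiv k (chainMors n hn a)) = 0}

/-- Extension of a tuple indexed by `Fin n` to `ℕ` by a constant value. -/
def extendBy {R : Type*} {n : ℕ} (d : R) (z : Fin n → R) (k : ℕ) : R :=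
  if h : k < n then z ⟨k, h⟩ else d

/-- Milnor numbers of the initial segments of a sequence, by their recursion. -/
def muRec (A : ℕ → ℕ) : ℕ → ℤ
  | 0 => 1
  | k + 1 => A k * muRec A k + (-1) ^ (k + 1)

/-- The exponent of `z_0` in the expression of `z_k` at a critical point. -/
def critExp (A : ℕ → ℕ) (k : ℕ) : ℤ := (-1) ^ k * muRec A k

/-- The coefficient in the expression of `z_k` at a critical point. -/
noncomputable def critCoeff (A : ℕ → ℕ) : ℕ → ℂ
  | 0 => 1
  | k + 1 => (-1) ^ (k + 1) / (∏ i ∈ Finset.range (k + 1), (A i : ℂ)) / critCoeff A k ^ A k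

/-- The equation `∂g/∂z_k = 0` for sequences. -/
def CritEq (A : ℕ → ℕ) (Z : ℕ → ℂ) (k : ℕ) : Prop :=
  A k * Z k ^ (A k - 1) * Z (k + 1) + (if k = 0 then 1 else Z (k - 1) ^ A (k - 1)) = 0

theorem extendBy_val {R : Type*} {n : ℕ} (d : R) (z : Fin n → R) (k : Fin n) :
    extendBy d z k = z k := by
  simp [extendBy]

theorem extendBy_of_lt {R : Type*} {n : ℕ} (d : R) (z : Fin n → R) {k : ℕ} (h : k < n) :
    extendBy d z k = z ⟨k, h⟩ := by
  simp [extendBy, h]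

theorem extendBy_self {R : Type*} {n : ℕ} (d : R) (z : Fin n → R) : extendBy d z n = d := by
  simp [extendBy]

theorem muRec_eq_sum (A : ℕ → ℕ) (n : ℕ) :
    muRec A n = ∑ k ∈ Finset.range (n + 1), (-1 : ℤ) ^ k * ∏ i ∈ Finset.Ico k n, (A i : ℤ) := by
  induction n with
  | zero => simp [muRec]
  | succ n ih =>
    rw [Finset.sum_range_succ, muRec, ih, Finset.mul_sum]
    simp only [Finset.Ico_self, Finset.prod_empty, mul_one, add_left_inj]
    refine Finset.sum_congr rfl fun k hk => ?_
    rw [Finset.prod_Ico_succ_top (by simpa [Nat.lt_succ_iff] using hk)]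
    ring

theorem prod_drop_ofFn {n : ℕ} (a : Fin n → ℕ) (k : ℕ) (hk : k ≤ n) :
    ((List.ofFn a).drop k).prod = ∏ i ∈ Finset.Ico k n, extendBy 1 a i := by
  induction hk using Nat.decreasingInduction with
  | self => simp [List.drop_of_length_le]
  | of_succ k hk ih =>
    rw [List.drop_eq_getElem_cons (by simpa using hk), List.prod_cons, ih,
      Finset.prod_eq_prod_Ico_succ_bot hk]
    simp [extendBy, hk]

theorem chainMu_ofFn {n : ℕ} (a : Fin n → ℕ) :
    chainMu (List.ofFn a) = muRec (extendBy 1 a) n := by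
  rw [muRec_eq_sum, chainMu, List.length_ofFn]
  refine Finset.sum_congr rfl fun k hk => ?_
  rw [prod_drop_ofFn a k (by simpa [Nat.lt_succ_iff] using hk)]
  push_cast
  rfl

theorem muRec_nonneg {A : ℕ → ℕ} {n : ℕ} (hA : ∀ k < n, 0 < A k) {k : ℕ} (hk : k ≤ n) :
    0 ≤ muRec A k ∧ (Even k → 0 < muRec A k) := by
  induction k with
  | zero => simp [muRec]
  | succ k ih =>
    obtain ⟨h0, h1⟩ := ih (by omega)
    have hAk : (1 : ℤ) ≤ A k := by exact_mod_cast hA k hk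
    rcases Nat.even_or_odd k with he | ho
    · have := h1 he
      rw [muRec, he.add_one.neg_one_pow]
      refine ⟨by nlinarith, fun h => ?_⟩
      exact absurd h (Nat.not_even_iff_odd.2 he.add_one)
    · rw [muRec, ho.add_one.neg_one_pow]
      have : 0 ≤ (A k : ℤ) * muRec A k := by positivity
      exact ⟨by omega, fun _ => by omega⟩

theorem muRec_pos {A : ℕ → ℕ} {n : ℕ} (hn : 0 < n) (hA : ∀ k < n, 0 < A k)
    (hlast : 2 ≤ A (n - 1)) : 0 < muRec A n := by
  obtain ⟨k, rfl⟩ : ∃ k, n = k + 1 := ⟨n - 1, by omega⟩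
  obtain ⟨h0, h1⟩ := muRec_nonneg hA (Nat.le_succ k)
  have hAk : (2 : ℤ) ≤ A k := by exact_mod_cast hlast
  rcases Nat.even_or_odd k with he | ho
  · have := h1 he
    rw [muRec, he.add_one.neg_one_pow]
    nlinarith
  · rw [muRec, ho.add_one.neg_one_pow]
    have : 0 ≤ (A k : ℤ) * muRec A k := by positivity
    omega

theorem critExp_succ (A : ℕ → ℕ) (k : ℕ) : critExp A (k + 1) = 1 - A k * critExp A k := by
  have h : ((-1 : ℤ) ^ k) * (-1) ^ k = 1 := by rw [← mul_pow]; simp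
  simp only [critExp, muRec, pow_succ]
  linear_combination h

theorem prod_range_ne_zero {A : ℕ → ℕ} {n : ℕ} (hA : ∀ k < n, 0 < A k) {k : ℕ} (hk : k ≤ n) :
    (∏ i ∈ Finset.range k, (A i : ℂ)) ≠ 0 := by
  refine Finset.prod_ne_zero_iff.2 fun i hi => ?_
  have := hA i (by have := Finset.mem_range.1 hi; omega)
  exact_mod_cast this.ne'

theorem critCoeff_ne_zero {A : ℕ → ℕ} {n : ℕ} (hA : ∀ k < n, 0 < A k) {k : ℕ} (hk : k ≤ n) :
    critCoeff A k ≠ 0 := by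
  induction k with
  | zero => simp [critCoeff]
  | succ k ih =>
    exact div_ne_zero (div_ne_zero (by simp) (prod_range_ne_zero hA hk))
      (pow_ne_zero _ (ih (by omega)))

section Sequences

variable {A : ℕ → ℕ} {Z : ℕ → ℂ} {n : ℕ}

theorem CritEq.eq_zero_of_succ_eq_zero {k : ℕ} (h : CritEq A Z k) (h0 : Z (k + 1) = 0) :
    k ≠ 0 ∧ Z (k - 1) = 0 := by
  rw [CritEq, h0, mul_zero, zero_add] at h
  split_ifs at h with hk
  · exact absurd h one_ne_zero
  · exact ⟨hk, eq_zero_of_pow_eq_zero h⟩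

theorem CritEq.not_consecutive_zeros (hc : ∀ k < n, CritEq A Z k) {k : ℕ} (hk : k < n)
    (h0 : Z k = 0) (h1 : Z (k + 1) = 0) : False := by
  induction k with
  | zero => exact ((hc 0 hk).eq_zero_of_succ_eq_zero h1).1 rfl
  | succ k ih => exact ih (by omega) ((hc _ hk).eq_zero_of_succ_eq_zero h1).2 h0

theorem CritEq.ne_zero (hA : ∀ k < n, 0 < A k) (hn : 0 < n) (hlast : 2 ≤ A (n - 1))
    (hZ : Z n = 1) (hc : ∀ k < n, CritEq A Z k) {k : ℕ} (hk : k ≤ n) : Z k ≠ 0 := by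
  obtain ⟨m, rfl⟩ : ∃ m, n = m + 1 := ⟨n - 1, by omega⟩
  rw [Nat.add_sub_cancel] at hlast
  have key : ∀ k ≤ m, Z k ≠ 0 ∧ Z (k + 1) ≠ 0 := by
    intro k hk
    induction hk using Nat.decreasingInduction with
    | self =>
      refine ⟨fun h0 => ?_, by simp [hZ]⟩
      have h := hc m (by omega)
      rw [CritEq, h0, zero_pow (by omega), mul_zero, zero_mul, zero_add] at h
      split_ifs at h with hm
      · exact absurd h one_ne_zero
      · have h2 := eq_zero_of_pow_eq_zero h
        refine CritEq.not_consecutive_zeros hc (k := m - 1) (by omega) h2 ?_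
        rwa [Nat.sub_add_cancel (by omega)]
    | of_succ k hk ih =>
      refine ⟨fun h0 => ?_, ih.1⟩
      have h := hc (k + 1) (by omega)
      simp only [CritEq, Nat.add_eq_zero_iff, one_ne_zero, and_false, if_false,
        Nat.add_sub_cancel, h0, zero_pow (hA k (by omega)).ne', add_zero] at h
      have hA' := hA (k + 1) (by omega)
      exact mul_ne_zero (mul_ne_zero (by exact_mod_cast hA'.ne') (pow_ne_zero _ ih.1)) ih.2 h
  rcases Nat.lt_or_ge m k with h | h
  · obtain rfl : k = m + 1 := by omega
    simp [hZ]
  · exact (key k h).1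

theorem critEq_iff {k : ℕ} (hA : 0 < A k) (hZ : Z k ≠ 0) :
    CritEq A Z k ↔
      A k * (Z k ^ A k * Z (k + 1)) + (if k = 0 then Z 0 else Z (k - 1) ^ A (k - 1) * Z k) = 0 := by
  obtain ⟨p, hp⟩ : ∃ p, A k = p + 1 := ⟨A k - 1, by omega⟩
  rw [CritEq, ← mul_left_inj' hZ, zero_mul, hp, Nat.add_sub_cancel, pow_succ]
  split_ifs with hk
  · subst hk
    ring_nf
  · ring_nf

/-- At a critical point, the monomials of the chain polynomial are proportional to `z_0`. -/
theorem critEq_iff_monomial (hA : ∀ k < n, 0 < A k) (hZ : ∀ k < n, Z k ≠ 0) :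
    (∀ k < n, CritEq A Z k) ↔
      ∀ k < n, (∏ i ∈ Finset.range (k + 1), (A i : ℂ)) * (Z k ^ A k * Z (k + 1)) =
        (-1) ^ (k + 1) * Z 0 := by
  constructor
  · intro h k hk
    induction k with
    | zero =>
      have := (critEq_iff (hA 0 hk) (hZ 0 hk)).1 (h 0 hk)
      simp only [if_true] at this
      rw [Finset.prod_range_one]
      linear_combination this
    | succ k ih =>
      have h1 := (critEq_iff (hA _ hk) (hZ _ hk)).1 (h _ hk)
      have h2 := ih (by omega)
      simp only [Nat.add_eq_zero_iff, one_ne_zero, and_false, if_false, Nat.add_sub_cancel] at h1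
      rw [Finset.prod_range_succ, pow_succ]
      linear_combination (∏ i ∈ Finset.range (k + 1), (A i : ℂ)) * h1 - h2
  · intro h k hk
    rw [critEq_iff (hA k hk) (hZ k hk)]
    cases k with
    | zero =>
      have := h 0 hk
      rw [Finset.prod_range_one] at this
      simp only [if_true]
      linear_combination this
    | succ k =>
      have h1 := h (k + 1) hk
      have h2 := h k (by omega)
      rw [Finset.prod_range_succ, pow_succ] at h1
      simp only [Nat.add_eq_zero_iff, one_ne_zero, and_false, if_false, Nat.add_sub_cancel]
      refine (mul_eq_zero.1 ?_).resolve_left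
        (prod_range_ne_zero hA (k := k + 1) (by omega))
      linear_combination h1 + h2

theorem critEq_iff_zpow (hA : ∀ k < n, 0 < A k) (hZ : ∀ k < n, Z k ≠ 0) (hn : 0 < n) :
    (∀ k < n, CritEq A Z k) ↔ ∀ k ≤ n, Z k = critCoeff A k * Z 0 ^ critExp A k := by
  rw [critEq_iff_monomial hA hZ]
  have hZ0 := hZ 0 hn
  have key : ∀ k < n, Z k = critCoeff A k * Z 0 ^ critExp A k →
      ((∏ i ∈ Finset.range (k + 1), (A i : ℂ)) * (Z k ^ A k * Z (k + 1)) =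
        (-1) ^ (k + 1) * Z 0 ↔
      Z (k + 1) = critCoeff A (k + 1) * Z 0 ^ critExp A (k + 1)) := by
    intro k hk hzk
    have hP := prod_range_ne_zero hA (k := k + 1) hk
    have hC := pow_ne_zero (A k) (critCoeff_ne_zero hA hk.le)
    have hE : (Z 0 ^ critExp A k) ^ A k ≠ 0 := pow_ne_zero _ (zpow_ne_zero _ hZ0)
    rw [critExp_succ, zpow_sub₀ hZ0, zpow_one, mul_comm (A k : ℤ), zpow_mul, zpow_natCast,
      critCoeff, hzk, mul_pow, div_div, div_mul_div_comm, eq_div_iff (by positivity)]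
    constructor <;> intro h <;> linear_combination h
  constructor
  · intro h k hk
    induction k with
    | zero => simp [critCoeff, critExp, muRec]
    | succ k ih => exact (key k hk (ih (by omega))).1 (h k hk)
  · intro h k hk
    exact (key k hk (h k hk.le)).2 (h (k + 1) hk)

theorem critValue_eq (hA : ∀ k < n, 0 < A k) (hZ : ∀ k < n, Z k ≠ 0)
    (hc : ∀ k < n, CritEq A Z k) {k : ℕ} (hk : k ≤ n) :
    (∏ i ∈ Finset.range k, (A i : ℂ)) *
      (∑ i ∈ Finset.range k, Z i ^ A i * Z (i + 1) + Z 0) = muRec A k * Z 0 := by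
  induction k with
  | zero => simp [muRec]
  | succ k ih =>
    have h1 := (critEq_iff_monomial hA hZ).1 hc k hk
    have h2 := ih (by omega)
    rw [Finset.prod_range_succ] at h1
    rw [Finset.sum_range_succ, Finset.prod_range_succ, muRec]
    push_cast
    linear_combination (A k : ℂ) * h2 + h1

/-- The kernel of the Hessian at a critical point is trivial. -/
theorem CritEq.eq_zero_of_hessian (hA : ∀ k < n, 0 < A k) (hZ : ∀ k ≤ n, Z k ≠ 0)
    (hc : ∀ k < n, CritEq A Z k) (hmu : muRec A n ≠ 0) {V : ℕ → ℂ} (hV : V n = 0)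
    (hH : ∀ k < n, A k * (((A k - 1 : ℕ) : ℂ) * Z k ^ (A k - 1 - 1) * V k * Z (k + 1) +
        Z k ^ (A k - 1) * V (k + 1)) +
      (if k = 0 then 0 else A (k - 1) * Z (k - 1) ^ (A (k - 1) - 1) * V (k - 1)) = 0)
    {k : ℕ} (hk : k ≤ n) : V k = 0 := by
  obtain ⟨U, hVU⟩ : ∃ U : ℕ → ℂ, ∀ k ≤ n, V k = U k * Z k :=
    ⟨fun k => V k / Z k, fun k hk => (div_mul_cancel₀ _ (hZ k hk)).symm⟩
  have hpow : ∀ (p : ℕ) (x : ℂ), (p : ℂ) * x ^ (p - 1) * x = p * x ^ p := by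
    intro p x
    cases p with
    | zero => simp
    | succ p => rw [Nat.add_sub_cancel]; ring
  have hrec : ∀ k < n, U (k + 1) + ((A k : ℂ) - 1) * U k -
      (if k = 0 then 0 else A (k - 1) * U (k - 1)) = 0 := by
    intro k hk
    have h := hH k hk
    have hAk := hA k hk
    have hk1 : k - 1 ≤ n := by omega
    rw [hVU k hk.le, hVU (k + 1) hk, hVU (k - 1) hk1] at h
    have hz := (critEq_iff hAk (hZ k hk.le)).1 (hc k hk)
    obtain ⟨p, hp⟩ : ∃ p, A k = p + 1 := ⟨A k - 1, by omega⟩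
    have hpp := hpow p (Z k)
    have ht : (A k : ℂ) * (Z k ^ A k * Z (k + 1)) ≠ 0 :=
      mul_ne_zero (by exact_mod_cast hAk.ne')
        (mul_ne_zero (pow_ne_zero _ (hZ k hk.le)) (hZ (k + 1) hk))
    refine (mul_eq_zero.1 ?_).resolve_left ht
    rw [hp, Nat.add_sub_cancel] at h
    rw [hp] at hz ⊢
    push_cast at h hz ⊢
    split_ifs at h hz ⊢ with hk0
    · linear_combination Z k * h - (p + 1 : ℂ) * Z (k + 1) * U k * Z k * hpp
    · have hq : Z (k - 1) ^ (A (k - 1) - 1) * Z (k - 1) = Z (k - 1) ^ A (k - 1) := by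
        rw [← pow_succ, Nat.sub_add_cancel (hA (k - 1) (by omega))]
      linear_combination Z k * h - (p + 1 : ℂ) * Z (k + 1) * U k * Z k * hpp
        - (A (k - 1) : ℂ) * U (k - 1) * Z k * hq - (A (k - 1) : ℂ) * U (k - 1) * hz
  have hU : ∀ k, (k ≤ n → U k = critExp A k * U 0) ∧
      (k + 1 ≤ n → U (k + 1) = critExp A (k + 1) * U 0) := by
    intro k
    induction k with
    | zero =>
      refine ⟨fun _ => by simp [critExp, muRec], fun h => ?_⟩
      have := hrec 0 h
      rw [critExp_succ]
      simp only [critExp, muRec, if_true] at this ⊢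
      push_cast
      linear_combination this
    | succ k ih =>
      refine ⟨ih.2, fun h => ?_⟩
      have h0 := ih.1 (by omega)
      have h1 := ih.2 (by omega)
      have h2 := hrec (k + 1) h
      simp only [Nat.add_eq_zero_iff, one_ne_zero, and_false, if_false, Nat.add_sub_cancel] at h2
      have h3 : (critExp A (k + 1) : ℂ) = 1 - A k * critExp A k := by
        rw [critExp_succ]; push_cast; rfl
      rw [critExp_succ]
      push_cast
      linear_combination h2 + (A k : ℂ) * h0 - ((A (k + 1) : ℂ) - 1) * h1 + U 0 * h3
  have hUn := (hU n).1 le_rfl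
  rw [hVU n le_rfl] at hV
  have hE : (critExp A n : ℂ) ≠ 0 := by
    simp [critExp, hmu]
  have hU0 : U 0 = 0 := by
    rw [(mul_eq_zero.1 hV).resolve_right (hZ n le_rfl)] at hUn
    exact (mul_eq_zero.1 hUn.symm).resolve_left hE
  simp [hVU k hk, (hU k).1 hk, hU0]

end Sequences

section Derivatives

variable {n : ℕ}

theorem pderiv_extendBy_X (j : Fin n) (k : ℕ) :
    pderiv j (extendBy (1 : MvPolynomial (Fin n) ℂ) X k) = if k = j then 1 else 0 := by
  unfold extendBy
  split_ifs with h1 h2 h2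
  · obtain rfl : (⟨k, h1⟩ : Fin n) = j := Fin.ext h2
    simp
  · exact pderiv_X_of_ne fun h => h2 (by rw [← h])
  · exact absurd (h2 ▸ j.isLt) h1
  · simp

theorem eval_extendBy_X (z : Fin n → ℂ) (k : ℕ) :
    eval z (extendBy (1 : MvPolynomial (Fin n) ℂ) X k) = extendBy 1 z k := by
  unfold extendBy
  split_ifs <;> simp

theorem chainMors_eq (hn : 0 < n) (a : Fin n → ℕ) :
    chainMors n hn a = ∑ k ∈ Finset.range n,
      extendBy (1 : MvPolynomial (Fin n) ℂ) X k ^ extendBy 1 a k *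
        extendBy (1 : MvPolynomial (Fin n) ℂ) X (k + 1) +
      extendBy (1 : MvPolynomial (Fin n) ℂ) X 0 := by
  rw [chainMors, chainMv, Finset.sum_range, extendBy_of_lt _ _ hn]
  simp only [extendBy_val]
  rfl

theorem pderiv_chainMors (hn : 0 < n) (a : Fin n → ℕ) (j : Fin n) :
    pderiv j (chainMors n hn a) =
      ((extendBy 1 a j : ℕ) : MvPolynomial (Fin n) ℂ) *
        extendBy (1 : MvPolynomial (Fin n) ℂ) X j ^ (extendBy 1 a j - 1) *
        extendBy (1 : MvPolynomial (Fin n) ℂ) X (j + 1) +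
      (if (j : ℕ) = 0 then 1 else
        extendBy (1 : MvPolynomial (Fin n) ℂ) X (j - 1) ^ extendBy 1 a (j - 1)) := by
  rw [chainMors_eq, map_add, map_sum]
  simp only [pderiv_mul, pderiv_pow, pderiv_extendBy_X, mul_ite, ite_mul, mul_one, mul_zero,
    zero_mul, Finset.sum_add_distrib]
  rw [Finset.sum_ite_eq' (Finset.range n), if_pos (Finset.mem_range.2 j.isLt), add_assoc]
  congr 1
  obtain ⟨j, hj⟩ := j
  cases j with
  | zero => simp
  | succ j =>
    simp only [Nat.add_right_cancel_iff, Nat.add_sub_cancel]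
    rw [Finset.sum_ite_eq' (Finset.range n), if_pos (Finset.mem_range.2 (by omega))]
    simp

theorem mem_morsCrit_iff (hn : 0 < n) (a : Fin n → ℕ) (z : Fin n → ℂ) :
    z ∈ morsCrit n hn a ↔ ∀ k < n, CritEq (extendBy 1 a) (extendBy 1 z) k := by
  have h : ∀ j : Fin n, eval z (pderiv j (chainMors n hn a)) = 0 ↔
      CritEq (extendBy 1 a) (extendBy 1 z) j := by
    intro j
    rw [pderiv_chainMors, CritEq]
    simp only [map_add, map_mul, map_pow, map_natCast, eval_extendBy_X,
      apply_ite (eval z), map_one]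
  simp only [morsCrit, Set.mem_ofPred_eq, h]
  exact ⟨fun H k hk => H ⟨k, hk⟩, fun H j => H j j.isLt⟩

theorem eval_chainMors (hn : 0 < n) (a : Fin n → ℕ) (z : Fin n → ℂ) :
    eval z (chainMors n hn a) = ∑ k ∈ Finset.range n,
      extendBy 1 z k ^ extendBy 1 a k * extendBy 1 z (k + 1) + extendBy 1 z 0 := by
  rw [chainMors_eq]
  simp [eval_extendBy_X]

/-- The directional derivative of `p` at `z` in the direction `v`. -/
noncomputable def dirDeriv (z v : Fin n → ℂ) (p : MvPolynomial (Fin n) ℂ) : ℂ :=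
  ∑ i, v i * eval z (pderiv i p)

theorem dirDeriv_add (z v : Fin n → ℂ) (p q : MvPolynomial (Fin n) ℂ) :
    dirDeriv z v (p + q) = dirDeriv z v p + dirDeriv z v q := by
  simp [dirDeriv, mul_add, Finset.sum_add_distrib]

theorem dirDeriv_mul (z v : Fin n → ℂ) (p q : MvPolynomial (Fin n) ℂ) :
    dirDeriv z v (p * q) = dirDeriv z v p * eval z q + eval z p * dirDeriv z v q := by
  simp only [dirDeriv, pderiv_mul, map_add, map_mul, Finset.sum_mul, Finset.mul_sum,
    ← Finset.sum_add_distrib]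
  exact Finset.sum_congr rfl fun i _ => by ring

theorem dirDeriv_pow (z v : Fin n → ℂ) (p : MvPolynomial (Fin n) ℂ) (m : ℕ) :
    dirDeriv z v (p ^ m) = m * eval z p ^ (m - 1) * dirDeriv z v p := by
  simp only [dirDeriv, pderiv_pow, map_mul, map_pow, map_natCast, Finset.mul_sum]
  exact Finset.sum_congr rfl fun i _ => by ring

theorem dirDeriv_natCast (z v : Fin n → ℂ) (m : ℕ) :
    dirDeriv z v (m : MvPolynomial (Fin n) ℂ) = 0 := by
  simp [dirDeriv]

theorem dirDeriv_one (z v : Fin n → ℂ) : dirDeriv z v 1 = 0 := by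
  simp [dirDeriv]

theorem dirDeriv_extendBy_X (z v : Fin n → ℂ) (k : ℕ) :
    dirDeriv z v (extendBy (1 : MvPolynomial (Fin n) ℂ) X k) = extendBy 0 v k := by
  unfold extendBy
  split_ifs with h
  · rw [dirDeriv, Finset.sum_eq_single ⟨k, h⟩]
    · simp
    · intro i _ hi
      simp [pderiv_X_of_ne hi.symm]
    · simp
  · exact dirDeriv_one z v

theorem dirDeriv_pderiv_chainMors (hn : 0 < n) (a : Fin n → ℕ) (z v : Fin n → ℂ) (j : Fin n) :
    dirDeriv z v (pderiv j (chainMors n hn a)) =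
      ((extendBy 1 a j : ℕ) : ℂ) * (((extendBy 1 a j - 1 : ℕ) : ℂ) *
          extendBy 1 z j ^ (extendBy 1 a j - 1 - 1) * extendBy 0 v j * extendBy 1 z (j + 1) +
        extendBy 1 z j ^ (extendBy 1 a j - 1) * extendBy 0 v (j + 1)) +
      (if (j : ℕ) = 0 then 0 else ((extendBy 1 a (j - 1) : ℕ) : ℂ) *
        extendBy 1 z (j - 1) ^ (extendBy 1 a (j - 1) - 1) * extendBy 0 v (j - 1)) := by
  rw [pderiv_chainMors, dirDeriv_add, apply_ite (dirDeriv z v)]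
  simp only [dirDeriv_mul, dirDeriv_pow, dirDeriv_natCast, dirDeriv_one, dirDeriv_extendBy_X,
    eval_extendBy_X, map_mul, map_pow, map_natCast]
  ring

end Derivatives

theorem ncard_pow_eq {m : ℕ} (hm : m ≠ 0) {c : ℂ} (hc : c ≠ 0) :
    {w : ℂ | w ^ m = c}.ncard = m := by
  have hroot : ∃ α : ℂ, α ^ m = c := IsAlgClosed.exists_pow_nat_eq c (Nat.pos_of_ne_zero hm)
  have hprim := Complex.isPrimitiveRoot_exp m hm
  have hset : {w : ℂ | w ^ m = c} = ((Polynomial.nthRoots m c).toFinset : Set ℂ) := by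
    ext w
    simp [Polynomial.mem_nthRoots (Nat.pos_of_ne_zero hm)]
  rw [hset, Set.ncard_coe_finset, Multiset.toFinset_card_of_nodup (hprim.nthRoots_nodup hc),
    hprim.card_nthRoots, if_pos hroot]

theorem exists_pow_eq_iff_zpow {m : ℕ} {C : ℂ} (hC : C ≠ 0) (n : ℕ) :
    ∃ c : ℂ, c ≠ 0 ∧ ∀ w : ℂ, w ^ m = c ↔ 1 = C * w ^ ((-1 : ℤ) ^ n * m) := by
  rcases Nat.even_or_odd n with h | h
  · refine ⟨C⁻¹, inv_ne_zero hC, fun w => ?_⟩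
    rw [h.neg_one_pow, one_mul, zpow_natCast, eq_comm (a := 1), mul_comm, mul_eq_one_iff_eq_inv₀ hC]
  · refine ⟨C, hC, fun w => ?_⟩
    rw [h.neg_one_pow, neg_one_mul, zpow_neg, zpow_natCast, eq_comm (a := 1)]
    constructor
    · intro hw
      rw [hw, mul_inv_cancel₀ hC]
    · intro hw
      by_cases h0 : w ^ m = 0
      · simp [h0] at hw
      · exact ((mul_inv_eq_one₀ h0).1 hw).symm

/-- For `a = (a_1,…,a_n)` positive with `a_n ≥ 2` and `g = p_a + z_1`, there is
`c ∈ ℂ*` such that `z ↦ z_1` is a bijection from the critical points of `g` onto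
`{w : w^{μ(a)} = c}`.  In particular `g` has exactly `μ(a)` critical points with
pairwise distinct critical values; the set of critical values is
`{(μ(a)/(a_1⋯a_n)) ⋅ w : w^{μ(a)} = c}` (equidistributed on a circle); and every
critical point is nondegenerate (nonvanishing complex Hessian determinant). -/
theorem stmt15 (n : ℕ) (hn : 0 < n) (a : Fin n → ℕ) (hpos : ∀ k, 0 < a k)
    (hlast : 2 ≤ a ⟨n - 1, by omega⟩)
    (m : ℕ) (hm : (m : ℤ) = chainMu (List.ofFn a)) :
    ∃ c : ℂ, c ≠ 0 ∧
      Set.BijOn (fun z : Fin n → ℂ => z ⟨0, hn⟩) (morsCrit n hn a)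
        {w : ℂ | w ^ m = c} ∧
      (morsCrit n hn a).ncard = m ∧
      Set.InjOn (fun z : Fin n → ℂ => eval z (chainMors n hn a)) (morsCrit n hn a) ∧
      (fun z : Fin n → ℂ => eval z (chainMors n hn a)) '' morsCrit n hn a =
        (fun w : ℂ => (chainMu (List.ofFn a) : ℂ) / (∏ k : Fin n, (a k : ℂ)) * w) ''
          {w : ℂ | w ^ m = c} ∧
      ∀ z ∈ morsCrit n hn a,
        (Matrix.of fun i j : Fin n =>
          eval z (pderiv i (pderiv j (chainMors n hn a)))).det ≠ 0 := by
  set A := extendBy 1 a with hAdef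
  have hA : ∀ k < n, 0 < A k := fun k hk => by
    rw [hAdef, extendBy_of_lt _ _ hk]
    exact hpos _
  have hlast' : 2 ≤ A (n - 1) := by
    rw [hAdef, extendBy_of_lt _ _ (by omega)]
    exact hlast
  have hmu := muRec_pos hn hA hlast'
  rw [chainMu_ofFn] at hm ⊢
  rw [← hAdef] at hm ⊢
  have hm0 : m ≠ 0 := by omega
  have hC : critCoeff A n ≠ 0 := critCoeff_ne_zero hA le_rfl
  obtain ⟨c, hc, hcw⟩ := exists_pow_eq_iff_zpow (m := m) hC n
  rw [hm] at hcw
  have hne : ∀ z ∈ morsCrit n hn a, ∀ k ≤ n, extendBy 1 z k ≠ 0 := fun z hz k hk =>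
    CritEq.ne_zero hA hn hlast' (extendBy_self _ _) ((mem_morsCrit_iff hn a z).1 hz) hk
  have hsol : ∀ z ∈ morsCrit n hn a, ∀ k ≤ n,
      extendBy 1 z k = critCoeff A k * z ⟨0, hn⟩ ^ critExp A k := fun z hz => by
    have h := (critEq_iff_zpow hA (fun k hk => hne z hz k hk.le) hn).1
      ((mem_morsCrit_iff hn a z).1 hz)
    rwa [extendBy_of_lt _ _ hn] at h
  have hval : ∀ z ∈ morsCrit n hn a, eval z (chainMors n hn a) =
      (muRec A n : ℂ) / (∏ k : Fin n, (a k : ℂ)) * z ⟨0, hn⟩ := fun z hz => by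
    have h := critValue_eq hA (fun k hk => hne z hz k hk.le)
      ((mem_morsCrit_iff hn a z).1 hz) le_rfl
    rw [← eval_chainMors hn, extendBy_of_lt _ _ hn] at h
    have hP := prod_range_ne_zero hA le_rfl
    rw [Finset.prod_range] at h hP
    simp only [hAdef, extendBy_val] at h hP ⊢
    field_simp
    linear_combination h
  have hbij : Set.BijOn (fun z : Fin n → ℂ => z ⟨0, hn⟩) (morsCrit n hn a)
      {w : ℂ | w ^ m = c} := by
    refine ⟨fun z hz => ?_, fun z hz z' hz' h => ?_, fun w hw => ?_⟩
    · have h := hsol z hz n le_rfl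
      rw [extendBy_self] at h
      exact (hcw _).2 h
    · funext k
      have h1 := hsol z hz k k.isLt.le
      have h2 := hsol z' hz' k k.isLt.le
      rw [extendBy_val] at h1 h2
      dsimp only at h
      rw [h1, h2, h]
    · have hw0 : w ≠ 0 := by
        rintro rfl
        rw [Set.mem_ofPred_eq, zero_pow hm0] at hw
        exact hc hw.symm
      set z : Fin n → ℂ := fun k => critCoeff A k * w ^ critExp A k with hz
      have hz0 : extendBy 1 z 0 = w := by
        simp [extendBy, hn, hz, critCoeff, critExp, muRec]
      have hzk : ∀ k ≤ n, extendBy 1 z k = critCoeff A k * w ^ critExp A k := by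
        intro k hk
        rcases hk.lt_or_eq with h | rfl
        · rw [extendBy_of_lt _ _ h]
        · rw [extendBy_self]
          exact (hcw w).1 hw
      refine ⟨z, (mem_morsCrit_iff hn a z).2 ((critEq_iff_zpow hA (fun k hk => ?_) hn).2 ?_), ?_⟩
      · rw [hzk k hk.le]
        exact mul_ne_zero (critCoeff_ne_zero hA hk.le) (zpow_ne_zero _ hw0)
      · rwa [hz0]
      · dsimp only
        rwa [extendBy_of_lt _ _ hn] at hz0
  refine ⟨c, hc, hbij, ?_, ?_, ?_, ?_⟩
  · rw [← ncard_pow_eq hm0 hc, ← hbij.image_eq, hbij.injOn.ncard_image]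
  · intro z hz z' hz' h
    refine hbij.injOn hz hz' ?_
    dsimp only at h ⊢
    rw [hval z hz, hval z' hz'] at h
    refine mul_left_cancel₀ (div_ne_zero (by exact_mod_cast hmu.ne') ?_) h
    exact Finset.prod_ne_zero_iff.2 fun k _ => by exact_mod_cast (hpos k).ne'
  · rw [← hbij.image_eq, Set.image_image]
    exact Set.image_congr hval
  · intro z hz hdet
    obtain ⟨v, hv0, hv⟩ := Matrix.exists_vecMul_eq_zero_iff.2 hdet
    refine hv0 (funext fun k => ?_)
    have hH : ∀ j : Fin n, dirDeriv z v (pderiv j (chainMors n hn a)) = 0 := fun j =>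
      congrFun hv j
    have h := CritEq.eq_zero_of_hessian hA (hne z hz) ((mem_morsCrit_iff hn a z).1 hz) hmu.ne'
      (extendBy_self 0 v) (fun k hk => by
        have := hH ⟨k, hk⟩
        rwa [dirDeriv_pderiv_chainMors] at this) k.isLt.le
    rwa [extendBy_val] at h
end

section
/- Let a = (a_1,…,a_n) be integers with all a_i ≥ 2, and define the critical set of the fibration f_a (projection of M_a := p_a^{−1}(1) to the first coordinate) as Crit := {z ∈ ℂ^n : p_a(z) = 1 and ∂p_a/∂z_k(z) = 0 for k = 2,…,n}. Then there exists C ∈ ℂ* such that z ↦ z_1 restricts to a bijection from Crit onto {w ∈ ℂ : w^{a_1a_2⋯a_n} = C}. In particular Crit has exactly a_1a_2⋯a_n elements and the critical values of f_a are a_1⋯a_n pairwise distinct points equidistributed on a circle centered at the origin. -/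
open MvPolynomial

/-- The critical set of the fibration `f_a : M_a → ℂ` (projection of
`M_a = p_a^{−1}(1)` to the first coordinate): points of `M_a` where
`∂p_a/∂z_k = 0` for all `k = 2, …, n`. -/
def fibCrit (n : ℕ) (a : Fin n → ℕ) : Set (Fin n → ℂ) :=
  {z | eval z (chainMv n a) = 1 ∧
    ∀ k : Fin n, (k : ℕ) ≠ 0 → eval z (pderiv k (chainMv n a)) = 0}

/-- Extension of a tuple to a sequence, by the constant value `1`. -/
def extendOne {R : Type*} [One R] {n : ℕ} (z : Fin n → R) (k : ℕ) : R :=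
  if h : k < n then z ⟨k, h⟩ else 1

lemma extendOne_val {R : Type*} [One R] {n : ℕ} (z : Fin n → R) (k : Fin n) :
    extendOne z k = z k := by
  simp [extendOne]

lemma extendOne_self {R : Type*} [One R] {n : ℕ} (z : Fin n → R) : extendOne z n = 1 := by
  simp [extendOne]

/-- The value at `z` of the `k`-th monomial of the chain polynomial. -/
def chainTerm {n : ℕ} (a : Fin n → ℕ) (z : Fin n → ℂ) (k : ℕ) : ℂ :=
  extendOne z k ^ extendOne a k * extendOne z (k + 1)

lemma eval_chain_summand {n : ℕ} (a : Fin n → ℕ) (z : Fin n → ℂ) (k : Fin n) :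
    eval z (X k ^ a k * (if h : (k : ℕ) + 1 < n then X (⟨(k : ℕ) + 1, h⟩ : Fin n) else 1)) =
      chainTerm a z k := by
  rw [chainTerm, extendOne_val, extendOne_val, extendOne]
  split_ifs <;> simp

lemma eval_chainMv {n : ℕ} (a : Fin n → ℕ) (z : Fin n → ℂ) :
    eval z (chainMv n a) = ∑ k ∈ Finset.range n, chainTerm a z k := by
  rw [chainMv, map_sum, ← Fin.sum_univ_eq_sum_range]
  exact Finset.sum_congr rfl fun k _ => eval_chain_summand a z k

lemma mul_eval_pderiv_pow {n : ℕ} (m : ℕ) (z : Fin n → ℂ) (j k : Fin n) :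
    z j * eval z (pderiv j (X k ^ m : MvPolynomial (Fin n) ℂ)) =
      if k = j then m * z k ^ m else 0 := by
  rw [pderiv_pow, pderiv_X]
  split_ifs with h
  · subst h
    cases m with
    | zero => simp
    | succ m => simp [pow_succ]; ring
  · simp [h]

lemma mul_eval_pderiv_chain_summand {n : ℕ} (a : Fin n → ℕ) (z : Fin n → ℂ) (j k : Fin n) :
    z j * eval z (pderiv j
      (X k ^ a k * (if h : (k : ℕ) + 1 < n then X (⟨(k : ℕ) + 1, h⟩ : Fin n) else 1))) =
      (if (k : ℕ) = j then a j * chainTerm a z j else 0) +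
        if (k : ℕ) + 1 = j then chainTerm a z k else 0 := by
  have hpow := mul_eval_pderiv_pow (a k) z j k
  rw [← eval_chain_summand a z j, ← eval_chain_summand a z k, pderiv_mul, map_add, mul_add,
    map_mul, ← mul_assoc, hpow]
  congr 1
  · by_cases h : k = j
    · subst h; simp only [if_true, map_mul, map_pow, eval_X, mul_assoc]
    · simp [h, Fin.val_ne_of_ne h]
  · by_cases h : (k : ℕ) + 1 < n
    · have hX := mul_eval_pderiv_pow 1 z j ⟨k + 1, h⟩
      rw [pow_one] at hX
      simp only [h, dif_pos, map_mul]
      rw [mul_left_comm, hX]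
      simp [Fin.ext_iff]
    · have : (k : ℕ) + 1 ≠ j := by have := j.2; omega
      simp [h, this]

lemma mul_eval_pderiv_chainMv {n : ℕ} (a : Fin n → ℕ) (z : Fin n → ℂ) (i : ℕ)
    (hi : i + 1 < n) :
    z ⟨i + 1, hi⟩ * eval z (pderiv ⟨i + 1, hi⟩ (chainMv n a)) =
      chainTerm a z i + a ⟨i + 1, hi⟩ * chainTerm a z (i + 1) := by
  rw [chainMv, map_sum, map_sum, Finset.mul_sum,
    Finset.sum_congr rfl fun k _ => mul_eval_pderiv_chain_summand a z ⟨i + 1, hi⟩ k,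
    Fin.sum_univ_eq_sum_range (fun k => (if k = i + 1 then
      a ⟨i + 1, hi⟩ * chainTerm a z (i + 1) else 0) + if k + 1 = i + 1 then chainTerm a z k else 0),
    Finset.sum_add_distrib, add_comm]
  simp [hi, Nat.lt_of_succ_lt hi]

/-- The ratio between the `k`-th and the last monomial at a critical point. -/
def chainRatio {n : ℕ} (a : Fin n → ℕ) (k : ℕ) : ℤ :=
  ∏ j ∈ Finset.Ico (k + 1) n, -((extendOne a j : ℕ) : ℤ)

lemma chainRatio_eq {n : ℕ} (a : Fin n → ℕ) {i : ℕ} (hi : i + 1 < n) :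
    chainRatio a i = -(a ⟨i + 1, hi⟩ : ℤ) * chainRatio a (i + 1) := by
  rw [chainRatio, Finset.prod_eq_prod_Ico_succ_bot hi, ← extendOne_val a ⟨i + 1, hi⟩]
  rfl

lemma chainRatio_ne_zero {n : ℕ} (a : Fin n → ℕ) (h2 : ∀ k, 2 ≤ a k) (k : ℕ) :
    chainRatio a k ≠ 0 := by
  refine Finset.prod_ne_zero_iff.mpr fun j hj => ?_
  have := h2 ⟨j, (Finset.mem_Ico.mp hj).2⟩
  rw [← extendOne_val a] at this
  simp only at this
  omega

lemma sum_chainRatio_ne_zero {n : ℕ} (hn : 0 < n) (a : Fin n → ℕ) (h2 : ∀ k, 2 ≤ a k) :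
    ∑ k ∈ Finset.range n, chainRatio a k ≠ 0 := by
  obtain ⟨m, rfl⟩ : ∃ m, n = m + 1 := ⟨n - 1, by omega⟩
  intro h
  rw [Finset.sum_range_succ, show chainRatio a m = 1 by simp [chainRatio]] at h
  have hm := h2 (Fin.last m)
  rw [← extendOne_val a, Fin.val_last] at hm
  have hdvd : ((extendOne a m : ℕ) : ℤ) ∣ ∑ k ∈ Finset.range m, chainRatio a k := by
    refine Finset.dvd_sum fun k hk => (neg_dvd.mp ?_)
    exact Finset.dvd_prod_of_mem (fun j => -((extendOne a j : ℕ) : ℤ))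
      (Finset.mem_Ico.mpr ⟨Finset.mem_range.mp hk, Nat.lt_succ_self m⟩)
  have h1 : ((extendOne a m : ℕ) : ℤ) ∣ 1 := (dvd_add_right hdvd).mp (h ▸ dvd_zero _)
  have := Int.le_of_dvd one_pos h1
  omega

/-- The common value of the `k`-th monomial at the critical points. -/
noncomputable def chainValue {n : ℕ} (a : Fin n → ℕ) (k : ℕ) : ℂ :=
  chainRatio a k / ((∑ i ∈ Finset.range n, chainRatio a i : ℤ) : ℂ)

lemma chainValue_ne_zero {n : ℕ} (hn : 0 < n) (a : Fin n → ℕ) (h2 : ∀ k, 2 ≤ a k) (k : ℕ) :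
    chainValue a k ≠ 0 :=
  div_ne_zero (Int.cast_ne_zero.mpr (chainRatio_ne_zero a h2 k))
    (Int.cast_ne_zero.mpr (sum_chainRatio_ne_zero hn a h2))

lemma mem_fibCrit_iff {n : ℕ} (hn : 0 < n) (a : Fin n → ℕ) (h2 : ∀ k, 2 ≤ a k)
    (z : Fin n → ℂ) :
    z ∈ fibCrit n a ↔ ∀ k < n, chainTerm a z k = chainValue a k := by
  have hS : ((∑ i ∈ Finset.range n, chainRatio a i : ℤ) : ℂ) ≠ 0 :=
    Int.cast_ne_zero.mpr (sum_chainRatio_ne_zero hn a h2)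
  constructor
  · rintro ⟨h1, hd⟩
    have hrec (i : ℕ) (hi : i + 1 < n) :
        chainTerm a z i = -a ⟨i + 1, hi⟩ * chainTerm a z (i + 1) := by
      have h := mul_eval_pderiv_chainMv a z i hi
      rw [hd ⟨i + 1, hi⟩ (Nat.succ_ne_zero i), mul_zero] at h
      linear_combination -h
    have hlast (k : ℕ) (hk : k ≤ n - 1) :
        chainTerm a z k = chainRatio a k * chainTerm a z (n - 1) := by
      induction hk using Nat.decreasingInduction with
      | self => simp [chainRatio, Nat.sub_add_cancel hn]
      | of_succ k hk ih =>
        have hk' : k + 1 < n := by omega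
        rw [hrec k hk', ih, chainRatio_eq a hk']
        push_cast
        ring
    rw [eval_chainMv, Finset.sum_congr rfl fun k hk =>
      hlast k (Nat.le_sub_one_of_lt (Finset.mem_range.mp hk)), ← Finset.sum_mul,
      ← Int.cast_sum] at h1
    intro k hk
    rw [hlast k (Nat.le_sub_one_of_lt hk), chainValue, eq_div_iff hS]
    linear_combination (chainRatio a k : ℂ) * h1
  · intro h
    refine ⟨?_, fun k hk => ?_⟩
    · rw [eval_chainMv, Finset.sum_congr rfl fun k hk => h k (Finset.mem_range.mp hk)]
      unfold chainValue
      rw [← Finset.sum_div, ← Int.cast_sum, div_self hS]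
    · obtain ⟨_ | i, hi⟩ := k
      · exact absurd rfl hk
      have hz : z ⟨i + 1, hi⟩ ≠ 0 := by
        intro hz
        have hc := h (i + 1) hi
        refine chainValue_ne_zero hn a h2 (i + 1) (hc ▸ ?_)
        have := h2 ⟨i + 1, hi⟩
        rw [chainTerm, ← Fin.val_mk hi, extendOne_val, extendOne_val, hz,
          zero_pow (by omega), zero_mul]
      refine (mul_eq_zero.mp ?_).resolve_left hz
      rw [mul_eval_pderiv_chainMv, h i (by omega), h _ hi, chainValue, chainValue,
        chainRatio_eq a hi]
      push_cast
      ring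

/-- The sequence of coordinates determined by a first coordinate `w` and prescribed values `c`
of the chain monomials with exponents `b`. -/
noncomputable def chainSeq (b : ℕ → ℕ) (c : ℕ → ℂ) (w : ℂ) : ℕ → ℂ
  | 0 => w
  | k + 1 => c k / chainSeq b c w k ^ b k

lemma chainSeq_eq_monomial (b : ℕ → ℕ) {c : ℕ → ℂ} (hc : ∀ k, c k ≠ 0) (k : ℕ) :
    ∃ d : ℂ, d ≠ 0 ∧
      ((∀ w, chainSeq b c w k = d * w ^ ∏ i ∈ Finset.range k, b i) ∨
        ∀ w, chainSeq b c w k = d * (w ^ ∏ i ∈ Finset.range k, b i)⁻¹) := by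
  induction k with
  | zero => exact ⟨1, one_ne_zero, Or.inl fun w => by simp [chainSeq]⟩
  | succ k ih =>
    obtain ⟨d, hd, h⟩ := ih
    refine ⟨c k / d ^ b k, div_ne_zero (hc k) (pow_ne_zero _ hd), ?_⟩
    refine h.symm.imp (fun h w => ?_) fun h w => ?_
    · rw [chainSeq, h, Finset.prod_range_succ, mul_pow, inv_pow, ← pow_mul, div_mul_eq_div_div,
        div_inv_eq_mul]
    · rw [chainSeq, h, Finset.prod_range_succ, mul_pow, ← pow_mul, div_mul_eq_div_div,
        div_eq_mul_inv _ (w ^ _)]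

lemma exists_chainSeq_eq_one_iff (b : ℕ → ℕ) {c : ℕ → ℂ} (hc : ∀ k, c k ≠ 0) (n : ℕ) :
    ∃ C : ℂ, C ≠ 0 ∧
      ∀ w, chainSeq b c w n = 1 ↔ w ^ ∏ i ∈ Finset.range n, b i = C := by
  obtain ⟨d, hd, h | h⟩ := chainSeq_eq_monomial b hc n
  · refine ⟨d⁻¹, inv_ne_zero hd, fun w => ?_⟩
    rw [h, mul_comm, ← eq_div_iff hd, one_div]
  · refine ⟨d, hd, fun w => ?_⟩
    rw [h, ← div_eq_mul_inv]
    constructor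
    · exact fun hw => (eq_of_div_eq_one hw).symm
    · intro hw
      rw [hw, div_self hd]

lemma chainSeq_ne_zero_of_le {b : ℕ → ℕ} {c : ℕ → ℂ} {w : ℂ} {n : ℕ} (hb : ∀ k < n, b k ≠ 0)
    (hw : chainSeq b c w n ≠ 0) {k : ℕ} (hk : k ≤ n) : chainSeq b c w k ≠ 0 := by
  induction hk using Nat.decreasingInduction with
  | self => exact hw
  | of_succ k hk ih =>
    intro h
    rw [chainSeq, h, zero_pow (hb k hk), div_zero] at ih
    exact ih rfl

lemma extendOne_eq_chainSeq {n : ℕ} (hn : 0 < n) {a : Fin n → ℕ} {z : Fin n → ℂ}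
    {c : ℕ → ℂ} (hc : ∀ k, c k ≠ 0)
    (h : ∀ k < n, chainTerm a z k = c k) {k : ℕ} (hk : k ≤ n) :
    extendOne z k = chainSeq (extendOne a) c (z ⟨0, hn⟩) k := by
  induction k with
  | zero => exact extendOne_val z ⟨0, hn⟩
  | succ k ih =>
    have hck := h k hk
    rw [chainTerm] at hck
    have hz : extendOne z k ^ extendOne a k ≠ 0 := fun h0 => hc k (by rw [← hck, h0, zero_mul])
    rw [chainSeq, ← ih (Nat.le_of_succ_le hk), eq_div_iff hz, mul_comm, hck]

lemma ncard_pow_eq_s16 {N : ℕ} (hN : 0 < N) {C : ℂ} (hC : C ≠ 0) :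
    {w : ℂ | w ^ N = C}.ncard = N := by
  have hζ := Complex.isPrimitiveRoot_exp N hN.ne'
  have hset : {w : ℂ | w ^ N = C} = ((Polynomial.nthRoots N C).toFinset : Set ℂ) := by
    ext w
    simp [Polynomial.mem_nthRoots hN]
  rw [hset, Set.ncard_coe_finset, Multiset.toFinset_card_of_nodup (hζ.nthRoots_nodup hC),
    hζ.card_nthRoots, if_pos (IsAlgClosed.exists_pow_nat_eq C hN)]

/-- For `a = (a_1,…,a_n)` with all `a_i ≥ 2`, there is `C ∈ ℂ*` such that
`z ↦ z_1` is a bijection from the critical set of `f_a` onto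
`{w : w^{a_1⋯a_n} = C}`.  In particular there are exactly `a_1⋯a_n` critical
points, and the critical values of `f_a` are `a_1⋯a_n` pairwise distinct points
equidistributed on a circle centered at the origin. -/
theorem stmt16 (n : ℕ) (hn : 0 < n) (a : Fin n → ℕ) (h2 : ∀ k, 2 ≤ a k) :
    ∃ C : ℂ, C ≠ 0 ∧
      Set.BijOn (fun z : Fin n → ℂ => z ⟨0, hn⟩) (fibCrit n a)
        {w : ℂ | w ^ (∏ k : Fin n, a k) = C} ∧
      (fibCrit n a).ncard = ∏ k : Fin n, a k := by
  have hc := chainValue_ne_zero hn a h2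
  have ha (k : Fin n) : a k ≠ 0 := by have := h2 k; omega
  obtain ⟨C, hC, hiff⟩ := exists_chainSeq_eq_one_iff (extendOne a) hc n
  have hprod : ∏ i ∈ Finset.range n, extendOne a i = ∏ k, a k := by
    rw [← Fin.prod_univ_eq_prod_range]
    exact Finset.prod_congr rfl fun k _ => extendOne_val a k
  rw [hprod] at hiff
  have hseq {z : Fin n → ℂ} (hz : z ∈ fibCrit n a) {k : ℕ} (hk : k ≤ n) :=
    extendOne_eq_chainSeq hn hc ((mem_fibCrit_iff hn a h2 z).mp hz) hk
  have hbij : Set.BijOn (fun z : Fin n → ℂ => z ⟨0, hn⟩) (fibCrit n a)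
      {w : ℂ | w ^ (∏ k : Fin n, a k) = C} := by
    refine ⟨fun z hz => ?_, fun z hz z' hz' h => ?_, fun w hw => ?_⟩
    · exact (hiff _).mp ((hseq hz le_rfl).symm.trans (extendOne_self z))
    · ext k
      rw [← extendOne_val z, ← extendOne_val z', hseq hz k.2.le, hseq hz' k.2.le]
      exact congrArg (fun w => chainSeq _ _ w _) h
    · have hw1 := (hiff w).mpr hw
      have hext {k : ℕ} (hk : k ≤ n) :
          extendOne (fun k : Fin n => chainSeq (extendOne a) (chainValue a) w k) k =
            chainSeq (extendOne a) (chainValue a) w k := by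
        obtain hk | rfl := hk.lt_or_eq
        · simp [extendOne, hk]
        · rw [extendOne_self, hw1]
      refine ⟨fun k => chainSeq (extendOne a) (chainValue a) w k,
        (mem_fibCrit_iff hn a h2 _).mpr fun k hk => ?_, rfl⟩
      rw [chainTerm, hext hk.le, hext hk, chainSeq]
      refine mul_div_cancel₀ _ (pow_ne_zero _ (chainSeq_ne_zero_of_le (n := n)
        (fun k hk => ?_) (hw1 ▸ one_ne_zero) hk.le))
      exact extendOne_val a ⟨k, hk⟩ ▸ ha ⟨k, hk⟩
  refine ⟨C, hC, hbij, ?_⟩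
  rw [← hbij.injOn.ncard_image, hbij.image_eq]
  exact ncard_pow_eq_s16 (Finset.prod_pos fun k _ => Nat.pos_of_ne_zero (ha k)) hC
end

section
/- Let a_0 ≥ 1 and a_1,…,a_n ≥ 2 be integers (n ≥ 1), let c ∈ ℂ be nonzero, and set d := a_1a_2⋯a_n, μ := μ(a_2,…,a_n), and F(z_0,z_1) := z_1^d − c·(z_0^{a_0}z_1 − 1)^μ. Then the affine plane curve {F = 0} ⊂ ℂ² is smooth: there is no point (z_0,z_1) ∈ ℂ² at which F, ∂F/∂z_0 and ∂F/∂z_1 all vanish. -/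
open MvPolynomial

/-- The plane curve polynomial `F(z_0, z_1) = z_1^d − c (z_0^{a_0} z_1 − 1)^μ`
in two variables. -/
noncomputable def planeF (a0 d m : ℕ) (c : ℂ) : MvPolynomial (Fin 2) ℂ :=
  X 1 ^ d - C c * (X 0 ^ a0 * X 1 - 1) ^ m

/-- Let `a_0 ≥ 1`, `a_1,…,a_n ≥ 2` (`n ≥ 1`), `c ≠ 0`, `d = a_1⋯a_n`,
`μ = μ(a_2,…,a_n)`, and `F(z_0,z_1) = z_1^d − c (z_0^{a_0} z_1 − 1)^μ`.  Then the
affine plane curve `{F = 0} ⊂ ℂ²` is smooth: there is no point at which `F`,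
`∂F/∂z_0` and `∂F/∂z_1` all vanish. -/
theorem stmt18 (a0 : ℕ) (h0 : 1 ≤ a0) (a : List ℕ) (hne : a ≠ [])
    (h2 : ∀ x ∈ a, 2 ≤ x) (c : ℂ) (hc : c ≠ 0)
    (m : ℕ) (hm : (m : ℤ) = chainMu a.tail) :
    ¬ ∃ z : Fin 2 → ℂ,
      eval z (planeF a0 a.prod m c) = 0 ∧
      eval z (pderiv 0 (planeF a0 a.prod m c)) = 0 ∧
      eval z (pderiv 1 (planeF a0 a.prod m c)) = 0 := by
  rintro ⟨z, hF, h0', h1'⟩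
  have hd : a.prod ≠ 0 := fun h => absurd (h2 0 (List.prod_eq_zero_iff.mp h)) (by norm_num)
  have ha0 : a0 ≠ 0 := Nat.one_le_iff_ne_zero.mp h0
  simp only [planeF, map_sub, map_mul, map_pow, eval_X, eval_C, map_one] at hF
  have hz1 : z 1 ≠ 0 := by
    intro h
    simp [h, hd, hc] at hF
  simp only [planeF, map_sub, Derivation.leibniz, Derivation.leibniz_pow, pderiv_C, pderiv_X_self,
    pderiv_X_of_ne (zero_ne_one : (0 : Fin 2) ≠ 1), pderiv_X_of_ne (one_ne_zero : (1 : Fin 2) ≠ 0),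
    Derivation.map_one_eq_zero, smul_eq_mul, nsmul_eq_mul, map_neg, map_mul, map_pow, map_natCast,
    eval_X, eval_C, map_one, mul_zero, mul_one, sub_zero, add_zero, zero_add, zero_sub] at h0' h1'
  have hpow : z 0 ^ (a0 - 1) * z 0 = z 0 ^ a0 := pow_sub_one_mul ha0 _
  have key : c * (m * ((z 0 ^ a0 * z 1 - 1) ^ (m - 1) * z 0 ^ a0)) = 0 := by
    have h : (a0 * z 1) * (c * (m * ((z 0 ^ a0 * z 1 - 1) ^ (m - 1) * z 0 ^ a0))) = 0 := by
      generalize (z 0 ^ a0 * z 1 - 1) ^ (m - 1) = u at h0' ⊢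
      linear_combination -z 0 * h0' - a0 * z 1 * c * m * u * hpow
    exact (mul_eq_zero.mp h).resolve_left (mul_ne_zero (Nat.cast_ne_zero.mpr ha0) hz1)
  rw [key, sub_zero] at h1'
  exact mul_ne_zero (Nat.cast_ne_zero.mpr hd) (pow_ne_zero _ hz1) h1'
end
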